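/- Let (X, μ) be a finite measure space, n an integer with n ≥ 2, and s, h : X → ℝ bounded measurable functions. Then the function G(t) = ∫_X |s(x) − n·t·h(x)|^n dμ(x) is twice differentiable on ℝ, and for every t ∈ ℝ its second derivative equals n³·(n−1)·∫_X h(x)²·|s(x) − n·t·h(x)|^{n−2} dμ(x), which is nonnegative; in particular G is convex on ℝ. -/

import Mathlib

open MeasureTheory Real

theorem hasDerivAt_mul_abs_pow (m : ℕ) (y : ℝ) :
    HasDerivAt (fun y : ℝ => y * |y| ^ m) (((m : ℝ) + 1) * |y| ^ m) y := by
  refine hasDerivAt_of_hasDerivAt_of_ne' (x := 0) (g := fun y : ℝ => ((m : ℝ) + 1) * |y| ^ m)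
    (fun z hz => ?_) (by fun_prop) (by fun_prop) y
  refine ((hasDerivAt_id z).mul ((hasDerivAt_abs hz).pow m)).congr_deriv ?_
  rcases m with _ | k
  · simp
  · have hsign : z * (SignType.sign z : ℝ) = |z| := self_mul_sign z
    simp only [id, Pi.pow_apply, Nat.add_sub_cancel]
    push_cast
    linear_combination ((k : ℝ) + 1) * |z| ^ k * hsign

theorem hasDerivAt_abs_pow_add_two (m : ℕ) (y : ℝ) :
    HasDerivAt (fun y : ℝ => |y| ^ (m + 2)) (((m : ℝ) + 2) * (y * |y| ^ m)) y := by
  have hfun : (fun y : ℝ => |y| ^ (m + 2)) = fun y => y * (y * |y| ^ m) := by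
    funext z
    rw [pow_add, sq_abs]
    ring
  rw [hfun]
  refine ((hasDerivAt_id y).mul (hasDerivAt_mul_abs_pow m y)).congr_deriv ?_
  simp only [id]
  ring

/-- Differentiation under the integral sign along an affine path of bounded functions. -/
theorem hasDerivAt_integral_mul_comp_sub {X : Type*} [MeasurableSpace X] {μ : Measure X}
    [IsFiniteMeasure μ] {φ φ' : ℝ → ℝ} (hφ : ∀ y, HasDerivAt φ (φ' y) y) (hφ' : Continuous φ')
    {w s h : X → ℝ} (hw : Measurable w) (hs : Measurable s) (hh : Measurable h) {C D : ℝ}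
    (hwb : ∀ x, |w x| ≤ D) (hsb : ∀ x, |s x| ≤ C) (hhb : ∀ x, |h x| ≤ C) (c t : ℝ) :
    HasDerivAt (fun t => ∫ x, w x * φ (s x - c * t * h x) ∂μ)
      (∫ x, w x * (φ' (s x - c * t * h x) * -(c * h x)) ∂μ) t := by
  have hφc : Continuous φ := continuous_iff_continuousAt.2 fun y => (hφ y).continuousAt
  have harg : ∀ (r : ℝ) (x : X), |r| ≤ |t| + 1 →
      s x - c * r * h x ∈ Set.Icc (-(C + |c| * (|t| + 1) * C)) (C + |c| * (|t| + 1) * C) := by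
    intro r x hr
    rw [Set.mem_Icc, ← abs_le]
    calc |s x - c * r * h x| ≤ |s x| + |c * r * h x| := abs_sub _ _
      _ = |s x| + |c| * |r| * |h x| := by rw [abs_mul, abs_mul]
      _ ≤ C + |c| * (|t| + 1) * C := by
        gcongr
        · exact hsb x
        · exact hhb x
  have hball : ∀ r ∈ Metric.ball t 1, |r| ≤ |t| + 1 := by
    intro r hr
    rw [Metric.mem_ball, Real.dist_eq] at hr
    linarith [abs_sub_abs_le_abs_sub r t]
  obtain ⟨A, hA⟩ := isCompact_Icc.exists_bound_of_continuousOn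
    (s := Set.Icc (-(C + |c| * (|t| + 1) * C)) (C + |c| * (|t| + 1) * C)) hφc.continuousOn
  obtain ⟨B, hB⟩ := isCompact_Icc.exists_bound_of_continuousOn
    (s := Set.Icc (-(C + |c| * (|t| + 1) * C)) (C + |c| * (|t| + 1) * C)) hφ'.continuousOn
  have hmeas : ∀ r : ℝ, Measurable fun x => s x - c * r * h x := fun r => by fun_prop
  refine (hasDerivAt_integral_of_dominated_loc_of_deriv_le
    (F := fun r x => w x * φ (s x - c * r * h x))
    (F' := fun r x => w x * (φ' (s x - c * r * h x) * -(c * h x)))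
    (bound := fun _ => D * (B * (|c| * C))) (Metric.ball_mem_nhds t one_pos)
    (.of_forall fun r => (hw.mul (hφc.measurable.comp (hmeas r))).aestronglyMeasurable)
    ?_ ?_ ?_ (integrable_const _) ?_).2
  · refine Integrable.of_bound
      (hw.mul (hφc.measurable.comp (hmeas t))).aestronglyMeasurable (D * A) (.of_forall fun x => ?_)
    rw [norm_mul]
    exact mul_le_mul (hwb x) (hA _ (harg t x (by linarith))) (norm_nonneg _)
      ((abs_nonneg _).trans (hwb x))
  · exact (hw.mul ((hφ'.measurable.comp (hmeas t)).mul
      (hh.const_mul c).neg)).aestronglyMeasurable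
  · refine .of_forall fun x r hr => ?_
    have hBx := hB _ (harg r x (hball r hr))
    rw [norm_mul, norm_mul, norm_neg, norm_mul]
    refine mul_le_mul (hwb x) (mul_le_mul hBx ?_ (by positivity) ((norm_nonneg _).trans hBx))
      (by positivity) ((abs_nonneg _).trans (hwb x))
    exact mul_le_mul_of_nonneg_left (hhb x) (abs_nonneg c)
  · refine .of_forall fun x r _ => ?_
    have hlin : HasDerivAt (fun r : ℝ => s x - c * r * h x) (-(c * h x)) r := by
      simpa using (((hasDerivAt_id r).const_mul c).mul_const (h x)).const_sub (s x)
    exact ((hφ _).comp r hlin).const_mul (w x)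

/-- second variation of the n-Calabi functional along a conformal ray:
`G(t) = ∫ |s − n t h|ⁿ dμ` is twice differentiable, with second derivative
`n³(n−1) ∫ h² |s − n t h|^{n−2} dμ ≥ 0`; in particular `G` is convex. -/
theorem stmt4 {X : Type*} [MeasurableSpace X] (μ : Measure X) [IsFiniteMeasure μ]
    (n : ℕ) (hn : 2 ≤ n)
    (s h : X → ℝ) (hs : Measurable s) (hh : Measurable h)
    (C : ℝ) (hsb : ∀ x, |s x| ≤ C) (hhb : ∀ x, |h x| ≤ C) :
    ∃ G' : ℝ → ℝ,
      (∀ t : ℝ, HasDerivAt (fun t : ℝ => ∫ x, |s x - (n : ℝ) * t * h x| ^ n ∂μ) (G' t) t) ∧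
      (∀ t : ℝ, HasDerivAt G'
          ((n : ℝ) ^ 3 * ((n : ℝ) - 1) * ∫ x, h x ^ 2 * |s x - (n : ℝ) * t * h x| ^ (n - 2) ∂μ) t) ∧
      (∀ t : ℝ,
        0 ≤ (n : ℝ) ^ 3 * ((n : ℝ) - 1) * ∫ x, h x ^ 2 * |s x - (n : ℝ) * t * h x| ^ (n - 2) ∂μ) ∧
      ConvexOn ℝ Set.univ (fun t : ℝ => ∫ x, |s x - (n : ℝ) * t * h x| ^ n ∂μ) := by
  obtain ⟨m, rfl⟩ := Nat.exists_eq_add_of_le' hn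
  have hG : ∀ t : ℝ, HasDerivAt
      (fun t : ℝ => ∫ x, |s x - ((m + 2 : ℕ) : ℝ) * t * h x| ^ (m + 2) ∂μ)
      (-((m : ℝ) + 2) ^ 2 * ∫ x, h x * ((s x - ((m + 2 : ℕ) : ℝ) * t * h x) *
        |s x - ((m + 2 : ℕ) : ℝ) * t * h x| ^ m) ∂μ) t := by
    intro t
    have key := hasDerivAt_integral_mul_comp_sub (μ := μ) (w := fun _ => 1) (D := 1)
      (hasDerivAt_abs_pow_add_two m) (by fun_prop) measurable_const hs hh (by simp) hsb hhb
      ((m + 2 : ℕ) : ℝ) t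
    simp only [one_mul] at key
    refine key.congr_deriv ?_
    rw [← integral_const_mul]
    congr 1 with x
    push_cast
    ring
  have hG' : ∀ t : ℝ, HasDerivAt
      (fun t : ℝ => -((m : ℝ) + 2) ^ 2 * ∫ x, h x * ((s x - ((m + 2 : ℕ) : ℝ) * t * h x) *
        |s x - ((m + 2 : ℕ) : ℝ) * t * h x| ^ m) ∂μ)
      (((m + 2 : ℕ) : ℝ) ^ 3 * (((m + 2 : ℕ) : ℝ) - 1) *
        ∫ x, h x ^ 2 * |s x - ((m + 2 : ℕ) : ℝ) * t * h x| ^ (m + 2 - 2) ∂μ) t := by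
    intro t
    refine ((hasDerivAt_integral_mul_comp_sub (μ := μ) (hasDerivAt_mul_abs_pow m) (by fun_prop)
      hh hs hh hhb hsb hhb ((m + 2 : ℕ) : ℝ) t).const_mul (-((m : ℝ) + 2) ^ 2)).congr_deriv ?_
    rw [← integral_const_mul, ← integral_const_mul]
    congr 1 with x
    rw [Nat.add_sub_cancel]
    push_cast
    ring
  have hnonneg : ∀ t : ℝ, 0 ≤ ((m + 2 : ℕ) : ℝ) ^ 3 * (((m + 2 : ℕ) : ℝ) - 1) *
      ∫ x, h x ^ 2 * |s x - ((m + 2 : ℕ) : ℝ) * t * h x| ^ (m + 2 - 2) ∂μ := by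
    intro t
    have hn1 : (0 : ℝ) ≤ ((m + 2 : ℕ) : ℝ) - 1 := by
      push_cast
      linarith [Nat.cast_nonneg (α := ℝ) m]
    exact mul_nonneg (mul_nonneg (by positivity) hn1) (integral_nonneg fun x => by positivity)
  have hderiv := funext fun t => (hG t).deriv
  refine ⟨_, hG, hG', hnonneg, convexOn_univ_of_deriv2_nonneg
    (fun t => (hG t).differentiableAt) ?_ fun t => ?_⟩
  · rw [hderiv]
    exact fun t => (hG' t).differentiableAt
  · rw [Function.iterate_succ_apply, Function.iterate_one, hderiv, (hG' t).deriv]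
    exact hnonneg t
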